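/- Let 0 < ω₀ < π, let ε > 0 with ε ≤ 1, let t ∈ ℂ, and let S = {y ∈ ℂ : 0 < |y| < ε and |arg y| < ω₀} be the open sector of radius ε and half-opening ω₀ around the positive real axis. Define u : S → ℂ by u(y) = (1 − (t/ω₀)·arg y)·ln |y| (this is the function φ₀(ω)·ln r written in polar coordinates, where φ₀ is the eigenvector of the nonlocal model problem at the eigenvalue 0). Then u is smooth on S, but the squared norm of its derivative is not integrable over S with respect to two-dimensional Lebesgue measure: ∫_S ‖Du(y)‖² dy = ∞. Consequently, u does not belong to the Sobolev space W₂¹ of the sector. -/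

import Mathlib

open Set Complex MeasureTheory

theorem Complex.contDiffAt_arg_real {y : ℂ} (hy : y ∈ slitPlane) {n : WithTop ℕ∞} :
    ContDiffAt ℝ n Complex.arg y := by
  have h : ContDiffAt ℝ n (fun z : ℂ => (Complex.log z).im) y :=
    imCLM.contDiff.contDiffAt.comp y ((Complex.contDiffAt_log hy).restrict_scalars ℝ)
  simpa only [Complex.log_im] using h

theorem Complex.mem_slitPlane_of_abs_arg_lt {y : ℂ} (hy : 0 < ‖y‖) {ω : ℝ} (hω : ω < Real.pi)
    (h : |arg y| < ω) : y ∈ slitPlane :=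
  mem_slitPlane_iff_arg.2 ⟨((le_abs_self _).trans_lt (h.trans hω)).ne, norm_pos_iff.1 hy⟩

theorem Complex.isOpen_sector {ω : ℝ} (hω : ω < Real.pi) (ε : ℝ) :
    IsOpen {y : ℂ | 0 < ‖y‖ ∧ ‖y‖ < ε ∧ |arg y| < ω} := by
  refine isOpen_iff_mem_nhds.2 fun y hy => ?_
  have harg := continuousAt_arg (mem_slitPlane_of_abs_arg_lt hy.1 hω hy.2.2)
  filter_upwards [continuous_norm.continuousAt.eventually_const_lt hy.1,
    continuous_norm.continuousAt.eventually_lt_const hy.2.1,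
    harg.abs.eventually_lt_const hy.2.2] with z h₁ h₂ h₃ using ⟨h₁, h₂, h₃⟩

theorem lintegral_Ioo_inv_eq_top {ε : ℝ} (hε : 0 < ε) :
    ∫⁻ r in Ioo 0 ε, ENNReal.ofReal r⁻¹ = ⊤ := by
  by_contra h
  have hint : IntegrableOn (fun r : ℝ => r⁻¹) (Ioo 0 ε) := by
    refine ⟨measurable_inv.aestronglyMeasurable, ?_⟩
    rw [hasFiniteIntegral_iff_ofReal]
    · exact lt_top_iff_ne_top.2 h
    · filter_upwards [ae_restrict_mem measurableSet_Ioo] with r hr using (inv_pos.2 hr.1).le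
  rw [← intervalIntegrable_iff_integrableOn_Ioo_of_le hε.le, intervalIntegrable_inv_iff] at hint
  exact hint.elim hε.ne fun h' => h' left_mem_uIcc

/-- A radial derivative of size at least `c / r` on a sector has infinite Dirichlet energy. -/
theorem Complex.lintegral_eq_top_of_radial_lower_bound {f : ℂ → ENNReal} {ε δ c : ℝ}
    (hε : 0 < ε) (hδ : 0 < δ) (hδπ : δ < Real.pi) (hc : 0 < c)
    (hf : ∀ r ∈ Ioo 0 ε, ∀ θ ∈ Ioo (-δ) δ,
      ENNReal.ofReal (c / r) ^ 2 ≤ f (Complex.polarCoord.symm (r, θ))) :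
    ∫⁻ y, f y = ⊤ := by
  rw [← Complex.lintegral_comp_polarCoord_symm, eq_top_iff]
  have hsub : Ioo 0 ε ×ˢ Ioo (-δ) δ ⊆ polarCoord.target := by
    rintro ⟨r, θ⟩ ⟨hr, hθ⟩
    exact ⟨hr.1, by linarith [hθ.1], by linarith [hθ.2]⟩
  calc (⊤ : ENNReal)
      = (∫⁻ r in Ioo 0 ε, ENNReal.ofReal r⁻¹) * ∫⁻ _ in Ioo (-δ) δ, ENNReal.ofReal (c ^ 2) := by
        rw [lintegral_Ioo_inv_eq_top hε, ENNReal.top_mul]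
        rw [setLIntegral_const, Real.volume_Ioo]
        refine mul_ne_zero ?_ ?_ <;> rw [Ne, ENNReal.ofReal_eq_zero, not_le]
        · positivity
        · linarith
    _ = ∫⁻ p in Ioo 0 ε ×ˢ Ioo (-δ) δ, ENNReal.ofReal p.1⁻¹ * ENNReal.ofReal (c ^ 2) := by
        rw [Measure.volume_eq_prod, ← Measure.prod_restrict,
          lintegral_prod_mul (f := fun r : ℝ => ENNReal.ofReal r⁻¹)
            (g := fun _ => ENNReal.ofReal (c ^ 2)) (by fun_prop) (by fun_prop)]
    _ ≤ ∫⁻ p in Ioo 0 ε ×ˢ Ioo (-δ) δ, ENNReal.ofReal p.1 • f (Complex.polarCoord.symm p) := by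
        refine setLIntegral_mono' (measurableSet_Ioo.prod measurableSet_Ioo) ?_
        rintro ⟨r, θ⟩ ⟨hr, hθ⟩
        have hr0 : 0 < r := hr.1
        calc ENNReal.ofReal r⁻¹ * ENNReal.ofReal (c ^ 2)
            = ENNReal.ofReal r * ENNReal.ofReal (c / r) ^ 2 := by
              rw [← ENNReal.ofReal_pow (by positivity), ← ENNReal.ofReal_mul (by positivity),
                ← ENNReal.ofReal_mul hr0.le]
              congr 1
              field_simp
          _ ≤ _ := mul_le_mul_right (hf r hr θ hθ) _
    _ ≤ _ := lintegral_mono_set hsub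

/-- `φ₀(ω)·ln r` has radial derivative `φ₀(ω) / r`. -/
theorem Complex.norm_div_le_norm_fderiv_of_eq_mul_log {u : ℂ → ℂ} {r θ ε : ℝ} {a : ℂ}
    (hr : r ∈ Ioo 0 ε) (hd : DifferentiableAt ℝ u (Complex.polarCoord.symm (r, θ)))
    (hu : ∀ s ∈ Ioo 0 ε, u (Complex.polarCoord.symm (s, θ)) = a * (Real.log s : ℂ)) :
    ‖a‖ / r ≤ ‖fderiv ℝ u (Complex.polarCoord.symm (r, θ))‖ := by
  simp only [Complex.polarCoord_symm_apply] at hd hu ⊢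
  set e : ℂ := Real.cos θ + Real.sin θ * I
  have he : ‖e‖ = 1 := by simp [e, norm_cos_add_sin_mul_I]
  have hline : HasDerivAt (fun s : ℝ => (s : ℂ) * e) e r := by
    simpa using (hasDerivAt_id r).ofReal_comp.mul_const e
  have h₁ : HasDerivAt (fun s : ℝ => u ((s : ℂ) * e)) (fderiv ℝ u (r * e) e) r :=
    hd.hasFDerivAt.comp_hasDerivAt r hline
  have h₂ : HasDerivAt (fun s : ℝ => a * (Real.log s : ℂ)) (a * ((r⁻¹ : ℝ) : ℂ)) r :=
    (Real.hasDerivAt_log hr.1.ne').ofReal_comp.const_mul a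
  have h₃ := h₁.unique (h₂.congr_of_eventuallyEq
    (Filter.eventuallyEq_of_mem (isOpen_Ioo.mem_nhds hr) hu))
  calc ‖a‖ / r = ‖fderiv ℝ u (r * e) e‖ := by
        rw [h₃, norm_mul, norm_real, Real.norm_of_nonneg (inv_pos.2 hr.1).le, div_eq_mul_inv]
    _ ≤ _ := by simpa [he] using (fderiv ℝ u (r * e)).le_opNorm e

/-- The function `φ₀(ω)·ln r` written in polar coordinates,
`u(y) = (1 − (t/ω₀)·arg y)·ln|y|`, is smooth on the open sector
`S = {0 < |y| < ε, |arg y| < ω₀}` (with `ε ≤ 1`), but the squared norm of its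
derivative is not integrable over `S`; hence `u ∉ W₂¹(S)`. -/
theorem eigenvector_log_not_in_W21
    (ω₀ : ℝ) (hω₀ : ω₀ ∈ Set.Ioo 0 Real.pi) (ε : ℝ) (hε : 0 < ε) (hε1 : ε ≤ 1)
    (t : ℂ)
    (S : Set ℂ)
    (hS : S = {y : ℂ | 0 < ‖y‖ ∧ ‖y‖ < ε ∧ |Complex.arg y| < ω₀})
    (u : ℂ → ℂ)
    (hu : ∀ y ∈ S, u y = (1 - (t / (ω₀ : ℂ)) * ((Complex.arg y : ℝ) : ℂ)) *
      ((Real.log ‖y‖ : ℝ) : ℂ)) :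
    ContDiffOn ℝ (⊤ : ℕ∞) u S ∧
    ∫⁻ y in S, (‖fderiv ℝ u y‖₊ : ENNReal) ^ 2 ∂volume = ⊤ := by
  obtain ⟨hω, hωπ⟩ := hω₀
  have hSo : IsOpen S := hS ▸ isOpen_sector hωπ ε
  have hsmooth : ContDiffOn ℝ (⊤ : ℕ∞) u S := by
    refine ContDiffOn.congr (fun y hy => ContDiffAt.contDiffWithinAt ?_) hu
    rw [hS] at hy
    have harg := ofRealCLM.contDiff.contDiffAt.comp y (contDiffAt_arg_real (n := (⊤ : ℕ∞))
      (mem_slitPlane_of_abs_arg_lt hy.1 hωπ hy.2.2))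
    have hlog := ofRealCLM.contDiff.contDiffAt.comp y
      ((contDiffAt_norm ℝ (n := (⊤ : ℕ∞)) (norm_pos_iff.1 hy.1)).log hy.1.ne')
    exact (contDiffAt_const.sub (contDiffAt_const.mul harg)).mul hlog
  refine ⟨hsmooth, ?_⟩
  rw [← lintegral_indicator hSo.measurableSet]
  set δ : ℝ := ω₀ / (2 * (‖t‖ + 1)) with hδ_def
  have hδ : 0 < δ := by positivity
  have hδω : δ < ω₀ := div_lt_self hω (by linarith [norm_nonneg t])
  refine lintegral_eq_top_of_radial_lower_bound hε hδ (hδω.trans hωπ) one_half_pos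
    fun r hr θ hθ => ?_
  have hθδ : |θ| < δ := abs_lt.2 hθ
  have harg : ∀ s ∈ Ioo 0 ε, arg (Complex.polarCoord.symm (s, θ)) = θ := fun s hs => by
    rw [Complex.polarCoord_symm_apply, ofReal_cos, ofReal_sin]
    exact arg_mul_cos_add_sin_mul_I hs.1 ⟨by linarith [hθ.1], by linarith [hθ.2]⟩
  have hnorm : ∀ s ∈ Ioo 0 ε, ‖Complex.polarCoord.symm (s, θ)‖ = s := fun s hs => by
    rw [norm_polarCoord_symm, abs_of_pos hs.1]
  have hmem : ∀ s ∈ Ioo 0 ε, Complex.polarCoord.symm (s, θ) ∈ S := fun s hs => by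
    rw [hS, mem_ofPred_eq, hnorm s hs, harg s hs]
    exact ⟨hs.1, hs.2, hθδ.trans hδω⟩
  have hsmall : ‖t / (ω₀ : ℂ) * (θ : ℂ)‖ ≤ 1 / 2 := by
    rw [norm_mul, norm_div, norm_real, norm_real, Real.norm_of_nonneg hω.le, Real.norm_eq_abs]
    calc ‖t‖ / ω₀ * |θ| ≤ (‖t‖ + 1) / ω₀ * δ := by gcongr; linarith
      _ = 1 / 2 := by rw [hδ_def]; field_simp
  have hlower : 1 / 2 ≤ ‖1 - t / (ω₀ : ℂ) * (θ : ℂ)‖ := by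
    have := norm_sub_norm_le (1 : ℂ) (t / (ω₀ : ℂ) * (θ : ℂ))
    rw [norm_one] at this
    linarith
  rw [indicator_of_mem (hmem r hr)]
  gcongr
  rw [← enorm_eq_nnnorm, ← ofReal_norm]
  refine ENNReal.ofReal_le_ofReal ?_
  refine (div_le_div_of_nonneg_right hlower hr.1.le).trans
    (norm_div_le_norm_fderiv_of_eq_mul_log hr ?_ fun s hs => ?_)
  · exact (hsmooth.contDiffAt (hSo.mem_nhds (hmem r hr))).differentiableAt (by simp)
  · rw [hu _ (hmem s hs), harg s hs, hnorm s hs]
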